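/- arXiv:2510.09950 — 7 statements merged into one kernel-verified Lean document; each statement's English description precedes it below -/
import Mathlib

section
/- Let p be a prime, H a finite relational structure, and π a p-automorphism of H (an automorphism with π ≠ id and π^p = id). Then for every finite structure G similar to H, the number of homomorphisms from G to H is congruent modulo p to the number of homomorphisms φ from G to H satisfying π ∘ φ = φ (equivalently, to the number of homomorphisms from G to the substructure of H induced on the fixed-point set Fix(π) = {x ∈ H : π x = x}, with each relation of H restricted to tuples with all entries in Fix(π)). -/
/-- `φ` is a homomorphism from the relational structure `(G, S)` to the similar
structure `(H, R)` over the signature `(n j)_{j : J}`. -/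
def IsHom {J : Type} (n : J → ℕ) {G H : Type}
    (S : ∀ j, Set (Fin (n j) → G)) (R : ∀ j, Set (Fin (n j) → H))
    (φ : G → H) : Prop :=
  ∀ j, ∀ t ∈ S j, (fun s => φ (t s)) ∈ R j

/-- `π` is a `p`-automorphism of the structure `(H, R)`:
an automorphism with `π ≠ id` and `π ^ p = id`. -/
def IsPAut {J : Type} (n : J → ℕ) {H : Type}
    (R : ∀ j, Set (Fin (n j) → H)) (p : ℕ) (π : Equiv.Perm H) : Prop :=
  IsHom n R R ⇑π ∧ IsHom n R R ⇑π.symm ∧ π ≠ 1 ∧ π ^ p = 1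

/-- A permutation `f` with `f ^ p = 1` has, modulo the prime `p`, as many fixed points as
there are points. -/
theorem natCard_eq_natCard_fixed_of_pow_eq_one {α : Type*} [Finite α] {p : ℕ} (hp : p.Prime)
    (f : Equiv.Perm α) (hf : f ^ p = 1) :
    (Nat.card α : ZMod p) = (Nat.card {a : α // f a = a} : ZMod p) := by
  classical
  have : Fact p.Prime := ⟨hp⟩
  have := Fintype.ofFinite α
  rw [ZMod.natCast_eq_natCast_iff, Nat.card_eq_fintype_card]
  have h := Equiv.Perm.card_fixedPoints_modEq (f := MulAction.toEndHom (α := α) f) (p := p)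
    (n := 1) (by rw [pow_one, ← map_pow, hf, map_one])
  exact h.trans (congrArg (· % p) Fintype.card_eq_nat_card)

theorem IsHom.comp {J : Type} {n : J → ℕ} {F G H : Type} {Q : ∀ j, Set (Fin (n j) → F)}
    {S : ∀ j, Set (Fin (n j) → G)} {R : ∀ j, Set (Fin (n j) → H)} {ψ : G → H} {φ : F → G}
    (hψ : IsHom n S R ψ) (hφ : IsHom n Q S φ) : IsHom n Q R (ψ ∘ φ) :=
  fun j t ht => hψ j _ (hφ j t ht)

/-- An automorphism of `H` permutes the homomorphisms into `H` by postcomposition. -/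
def homPerm {J : Type} {n : J → ℕ} {G H : Type} (S : ∀ j, Set (Fin (n j) → G))
    {R : ∀ j, Set (Fin (n j) → H)} (π : Equiv.Perm H) (hπ : IsHom n R R π)
    (hπs : IsHom n R R π.symm) : Equiv.Perm {φ : G → H // IsHom n S R φ} where
  toFun φ := ⟨π ∘ φ.1, hπ.comp φ.2⟩
  invFun φ := ⟨π.symm ∘ φ.1, hπs.comp φ.2⟩
  left_inv φ := by ext; simp
  right_inv φ := by ext; simp

theorem homPerm_pow_apply {J : Type} {n : J → ℕ} {G H : Type} (S : ∀ j, Set (Fin (n j) → G))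
    {R : ∀ j, Set (Fin (n j) → H)} (π : Equiv.Perm H) (hπ : IsHom n R R π)
    (hπs : IsHom n R R π.symm) (k : ℕ) (φ : {φ : G → H // IsHom n S R φ}) (x : G) :
    ((homPerm S π hπ hπs ^ k) φ).1 x = (π ^ k) (φ.1 x) := by
  induction k with
  | zero => rfl
  | succ k ih =>
    rw [pow_succ', pow_succ', Equiv.Perm.mul_apply, Equiv.Perm.mul_apply, ← ih]
    rfl

theorem stmt0 {J : Type} [Fintype J] (n : J → ℕ) (hn : ∀ j, 1 ≤ n j)
    {H : Type} [Fintype H] [Nonempty H]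
    (R : ∀ j, Set (Fin (n j) → H))
    (p : ℕ) (hp : p.Prime)
    (π : Equiv.Perm H) (hπ : IsPAut n R p π)
    {G : Type} [Fintype G] [Nonempty G]
    (S : ∀ j, Set (Fin (n j) → G)) :
    ((Nat.card {φ : G → H // IsHom n S R φ} : ZMod p)
        = (Nat.card {φ : G → H // IsHom n S R φ ∧ ∀ x, π (φ x) = φ x} : ZMod p)) ∧
    ((Nat.card {φ : G → H // IsHom n S R φ} : ZMod p)
        = (Nat.card {φ : G → {a : H // π a = a} //
            IsHom n S (fun j => {t : Fin (n j) → {a : H // π a = a} | (fun s => ((t s : {a : H // π a = a}) : H)) ∈ R j}) φ} : ZMod p)) := by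
  have key : (Nat.card {φ : G → H // IsHom n S R φ} : ZMod p)
      = (Nat.card {φ : G → H // IsHom n S R φ ∧ ∀ x, π (φ x) = φ x} : ZMod p) := by
    obtain ⟨h₁, h₂, -, hpow⟩ := hπ
    rw [natCard_eq_natCard_fixed_of_pow_eq_one hp (homPerm S π h₁ h₂) (by
      ext φ x
      simp [homPerm_pow_apply, hpow])]
    refine congrArg Nat.cast (Nat.card_congr ?_)
    refine (Equiv.subtypeEquivRight fun φ => ?_).trans
      (Equiv.subtypeSubtypeEquivSubtypeInter (fun φ : G → H => IsHom n S R φ)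
        fun φ => ∀ x, π (φ x) = φ x)
    exact Subtype.ext_iff.trans funext_iff
  refine ⟨key, key.trans (congrArg Nat.cast (Nat.card_congr ?_))⟩
  exact
    { toFun := fun φ => ⟨fun x => ⟨φ.1 x, φ.2.2 x⟩, φ.2.1⟩
      invFun := fun φ => ⟨fun x => φ.1 x, φ.2, fun x => (φ.1 x).2⟩
      left_inv := fun _ => rfl
      right_inv := fun _ => rfl }
end

section
/- Let m : Bool → Bool → Bool → Bool be a Mal'tsev operation, i.e., m x y y = x and m y y x = x for all x, y ∈ Bool. Define f x y z = m (m x y z) x (m x z y). If m is the minority operation (m x y z = x XOR y XOR z), then f x y z = x for all x, y, z (f is the first projection); otherwise, f is the minority operation, i.e., f x y z = x XOR y XOR z for all x, y, z. -/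
/-- The term `f(x,y,z) = m(m(x,y,z), x, m(x,z,y))` built from a ternary operation `m`. -/
def mTermF (m : Bool → Bool → Bool → Bool) (x y z : Bool) : Bool :=
  m (m x y z) x (m x z y)

theorem stmt8 (m : Bool → Bool → Bool → Bool)
    (h1 : ∀ x y, m x y y = x) (h2 : ∀ x y, m y y x = x) :
    ((∀ x y z, m x y z = Bool.xor x (Bool.xor y z)) →
        ∀ x y z, mTermF m x y z = x) ∧
    (¬ (∀ x y z, m x y z = Bool.xor x (Bool.xor y z)) →
        ∀ x y z, mTermF m x y z = Bool.xor x (Bool.xor y z)) := by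
  have e1 : m false false false = false := h1 _ _
  have e2 : m false false true = true := h2 _ _
  have e3 : m false true true = false := h1 _ _
  have e4 : m true false false = true := h1 _ _
  have e5 : m true true false = false := h2 _ _
  have e6 : m true true true = true := h1 _ _
  cases a : m false true false <;> cases b : m true false true <;>
    simp [mTermF, Bool.forall_bool, e1, e2, e3, e4, e5, e6, a, b]
end

section
/- Let m : Bool → Bool → Bool → Bool be any Mal'tsev operation, i.e., m x y y = x and m y y x = x for all x, y ∈ Bool. Define f x y z = m (m x y z) x (m x z y), g x y = f x x y, and h x y z = g (m x y z) (f x y z). Then h x y z = x XOR y XOR z for all x, y, z ∈ Bool; that is, the term h built from m alone is always the minority operation. -/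
/-- The term `g(x,y) = f(x,x,y)`. -/
def mTermG (m : Bool → Bool → Bool → Bool) (x y : Bool) : Bool :=
  mTermF m x x y

/-- The term `h(x,y,z) = g(m(x,y,z), f(x,y,z))`. -/
def mTermH (m : Bool → Bool → Bool → Bool) (x y z : Bool) : Bool :=
  mTermG m (m x y z) (mTermF m x y z)

theorem stmt9 (m : Bool → Bool → Bool → Bool)
    (h1 : ∀ x y, m x y y = x) (h2 : ∀ x y, m y y x = x) :
    ∀ x y z, mTermH m x y z = Bool.xor x (Bool.xor y z) := by
  intro x y z
  cases ha : m false true false <;> cases hb : m true false true <;>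
    cases x <;> cases y <;> cases z <;>
    simp [mTermH, mTermG, mTermF, h1, h2, ha, hb]
end

section
/- Let n be a natural number, R ⊆ (Fin n → Bool) a relation on the two-element set, and m : Bool → Bool → Bool → Bool a Mal'tsev operation (m x y y = x and m y y x = x for all x, y) that is a polymorphism of R. Then the minority operation (x, y, z) ↦ x XOR y XOR z is also a polymorphism of R. -/
theorem stmt10 {n : ℕ} (R : Set (Fin n → Bool)) (m : Bool → Bool → Bool → Bool)
    (h1 : ∀ x y, m x y y = x) (h2 : ∀ x y, m y y x = x)
    (hpoly : ∀ t₁ t₂ t₃ : Fin n → Bool, t₁ ∈ R → t₂ ∈ R → t₃ ∈ R →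
      (fun s => m (t₁ s) (t₂ s) (t₃ s)) ∈ R) :
    ∀ t₁ t₂ t₃ : Fin n → Bool, t₁ ∈ R → t₂ ∈ R → t₃ ∈ R →
      (fun s => Bool.xor (t₁ s) (Bool.xor (t₂ s) (t₃ s))) ∈ R := by
  intro t₁ t₂ t₃ ht₁ ht₂ ht₃
  have h_minority : (∀ x y z, m x y z = Bool.xor x (Bool.xor y z)) ∨
      ∀ x y z, m (m x y z) x (m x z y) = Bool.xor x (Bool.xor y z) := by
    cases ha : m false true false <;> cases hb : m true false true <;>
      simp [h1, h2, ha, hb]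
  rcases h_minority with h | h
  · simpa only [h] using hpoly t₁ t₂ t₃ ht₁ ht₂ ht₃
  · simpa only [h] using hpoly _ t₁ _ (hpoly t₁ t₂ t₃ ht₁ ht₂ ht₃) ht₁
      (hpoly t₁ t₃ t₂ ht₁ ht₃ ht₂)
end

section
/- Let H = Fin 3 with elements denoted 0, 1, 2, and let g₁, g₂ : H → H → H be binary operations such that the map G : H × H → H × H, G(x, y) = (g₁ x y, g₂ x y), is a bijection satisfying: G(0,0) = (0,0), G(1,1) = (1,1), G(2,2) = (2,2), G(2,0) = (2,1), G(2,1) = (2,0), and g₁ x y ∈ {0,1} and g₂ x y ∈ {0,1} whenever x, y ∈ {0,1}. Then there exists a binary operation f : H → H → H such that: (i) for every n and every relation R ⊆ (Fin n → H), if g₁ and g₂ are both binary polymorphisms of R, then f is a binary polymorphism of R; (ii) for every x ∈ H, the map f x : H → H is a bijection satisfying f x (f x y) = y for all y; and (iii) f x is not the identity for at least one x ∈ H. (That is, H has a 2-automorphic polynomial built from g₁ and g₂.) -/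
/-- `g` is a binary polymorphism of the relation `R ⊆ (Fin n → H)`. -/
def IsBinPoly {H : Type} {n : ℕ} (R : Set (Fin n → H)) (g : H → H → H) : Prop :=
  ∀ t₁ t₂ : Fin n → H, t₁ ∈ R → t₂ ∈ R → (fun s => g (t₁ s) (t₂ s)) ∈ R

/-- A relation with binary polymorphisms `g₁` and `g₂` has the polymorphism `g₂ (g₁ x y) y`. -/
theorem IsBinPoly.comp_left {H : Type} {n : ℕ} {R : Set (Fin n → H)} {g₁ g₂ : H → H → H}
    (h₁ : IsBinPoly R g₁) (h₂ : IsBinPoly R g₂) : IsBinPoly R (fun x y => g₂ (g₁ x y) y) :=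
  fun t₁ t₂ ht₁ ht₂ => h₂ _ t₂ (h₁ t₁ t₂ ht₁ ht₂) ht₂

theorem stmt11 (g₁ g₂ : Fin 3 → Fin 3 → Fin 3)
    (hbij : Function.Bijective (fun xy : Fin 3 × Fin 3 => (g₁ xy.1 xy.2, g₂ xy.1 xy.2)))
    (h00 : g₁ 0 0 = 0 ∧ g₂ 0 0 = 0)
    (h11 : g₁ 1 1 = 1 ∧ g₂ 1 1 = 1)
    (h22 : g₁ 2 2 = 2 ∧ g₂ 2 2 = 2)
    (h20 : g₁ 2 0 = 2 ∧ g₂ 2 0 = 1)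
    (h21 : g₁ 2 1 = 2 ∧ g₂ 2 1 = 0)
    (hpres : ∀ x y : Fin 3, x ∈ ({0, 1} : Set (Fin 3)) → y ∈ ({0, 1} : Set (Fin 3)) →
      g₁ x y ∈ ({0, 1} : Set (Fin 3)) ∧ g₂ x y ∈ ({0, 1} : Set (Fin 3))) :
    ∃ f : Fin 3 → Fin 3 → Fin 3,
      (∀ (n : ℕ) (R : Set (Fin n → Fin 3)),
        IsBinPoly R g₁ → IsBinPoly R g₂ → IsBinPoly R f) ∧
      (∀ x : Fin 3, Function.Bijective (f x) ∧ ∀ y, f x (f x y) = y) ∧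
      (∃ x : Fin 3, f x ≠ id) := by
  have inj : ∀ a b c d, g₁ a b = g₁ c d → g₂ a b = g₂ c d → a = c ∧ b = d := fun a b c d h h' =>
    Prod.mk.inj (hbij.1 (a₁ := (a, b)) (a₂ := (c, d)) (Prod.ext h h'))
  simp only [Set.mem_insert_iff, Set.mem_singleton_iff] at hpres
  have cases3 : ∀ z : Fin 3, z = 0 ∨ z = 1 ∨ z = 2 := by decide
  have swap : g₁ 0 1 = 0 ∧ g₂ 0 1 = 1 ∧ g₁ 1 0 = 1 ∧ g₂ 1 0 = 0 ∨
      g₁ 0 1 = 1 ∧ g₂ 0 1 = 0 ∧ g₁ 1 0 = 0 ∧ g₂ 1 0 = 1 := by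
    have h01 := hpres 0 1 (by simp) (by simp)
    have h10 := hpres 1 0 (by simp) (by simp)
    have := inj 0 1 0 0
    have := inj 0 1 1 1
    have := inj 1 0 0 0
    have := inj 1 0 1 1
    have := inj 0 1 1 0
    grind
  have hx2 : ∀ x, x ≠ 2 → g₂ x 2 = 2 ∧ (g₁ x 2 = 0 ∨ g₁ x 2 = 1) := by
    intro x hx
    have := inj x 2 0 0
    have := inj x 2 1 1
    have := inj x 2 2 2
    have := inj x 2 2 0
    have := inj x 2 2 1
    have := inj x 2 0 1
    have := inj x 2 1 0
    rcases cases3 (g₁ x 2) with h | h | h <;> rcases cases3 (g₂ x 2) with h' | h' | h' <;> grind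
  have h02 := hx2 0 (by decide)
  have h12 := hx2 1 (by decide)
  have f0 : ∀ y, g₂ (g₁ 0 y) y = y := by
    intro y
    rcases cases3 y with rfl | rfl | rfl <;> grind
  have f1 : ∀ y, g₂ (g₁ 1 y) y = y := by
    intro y
    rcases cases3 y with rfl | rfl | rfl <;> grind
  have invol : ∀ x, Function.Involutive (fun y => g₂ (g₁ x y) y) := by
    intro x y
    rcases cases3 x with rfl | rfl | rfl
    · simp only [f0]
    · simp only [f1]
    · rcases cases3 y with rfl | rfl | rfl <;> simp [h20, h21, h22]
  refine ⟨fun x y => g₂ (g₁ x y) y, fun n R h₁ h₂ => h₁.comp_left h₂,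
    fun x => ⟨(invol x).bijective, invol x⟩, 2, fun h => ?_⟩
  simpa [h20] using congrFun h 0
end

section
/- Let H = (H, (R j)_{j ∈ J}) be a finite relational structure such that some R j₀ is the full unary relation on H (n j₀ = 1 and R j₀ consists of all unary tuples). Then H has a Mal'tsev polymorphism (a ternary operation m : H³ → H with m x y y = m y y x = x preserving every R j) if and only if there exists a family of ternary operations m j : R j → R j → R j → R j, one for each j ∈ J, such that each m j satisfies the Mal'tsev identities m j a b b = a and m j b b a = a, and the family preserves all coordinate-agreement relations: for all j, j' ∈ J, all s ∈ Fin (n j), t ∈ Fin (n j'), and all a₁, a₂, a₃ ∈ R j, b₁, b₂, b₃ ∈ R j' with a_i s = b_i t for i = 1, 2, 3, one has (m j a₁ a₂ a₃) s = (m j' b₁ b₂ b₃) t. -/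
theorem stmt13 {J : Type} [Fintype J] (n : J → ℕ) (hn : ∀ j, 1 ≤ n j)
    {H : Type} [Fintype H] [Nonempty H]
    (R : ∀ j, Set (Fin (n j) → H))
    (j₀ : J) (hj₀ : n j₀ = 1) (hfull : R j₀ = Set.univ) :
    -- H has a Mal'tsev polymorphism
    (∃ m : H → H → H → H,
        (∀ x y, m x y y = x ∧ m y y x = x) ∧
        ∀ j, ∀ t₁ t₂ t₃ : Fin (n j) → H, t₁ ∈ R j → t₂ ∈ R j → t₃ ∈ R j →
          (fun s => m (t₁ s) (t₂ s) (t₃ s)) ∈ R j)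
      ↔
    -- its binarization has a Mal'tsev polymorphism
    (∃ M : ∀ j, (R j) → (R j) → (R j) → (R j),
        (∀ j, ∀ a b : R j, M j a b b = a ∧ M j b b a = a) ∧
        ∀ j j' : J, ∀ s : Fin (n j), ∀ t : Fin (n j'),
          ∀ a₁ a₂ a₃ : R j, ∀ b₁ b₂ b₃ : R j',
            (a₁ : Fin (n j) → H) s = (b₁ : Fin (n j') → H) t →
            (a₂ : Fin (n j) → H) s = (b₂ : Fin (n j') → H) t →
            (a₃ : Fin (n j) → H) s = (b₃ : Fin (n j') → H) t →
            (M j a₁ a₂ a₃ : Fin (n j) → H) s = (M j' b₁ b₂ b₃ : Fin (n j') → H) t) := by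
  constructor
  · rintro ⟨m, hm, hR⟩
    refine ⟨fun j a b c => ⟨fun s => m (a.1 s) (b.1 s) (c.1 s),
      hR j _ _ _ a.2 b.2 c.2⟩, fun j a b => ⟨?_, ?_⟩, ?_⟩
    · exact Subtype.ext (funext fun s => (hm _ _).1)
    · exact Subtype.ext (funext fun s => (hm _ _).2)
    · intro j j' s t a₁ a₂ a₃ b₁ b₂ b₃ h₁ h₂ h₃
      simp only [h₁, h₂, h₃]
  · rintro ⟨M, hM, hQ⟩
    let c : H → R j₀ := fun x => ⟨fun _ => x, hfull ▸ Set.mem_univ _⟩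
    let s₀ : Fin (n j₀) := ⟨0, hn j₀⟩
    refine ⟨fun x y z => (M j₀ (c x) (c y) (c z)).1 s₀, fun x y => ⟨?_, ?_⟩, ?_⟩
    · exact congrFun (congrArg Subtype.val (hM j₀ (c x) (c y)).1) s₀
    · exact congrFun (congrArg Subtype.val (hM j₀ (c x) (c y)).2) s₀
    · intro j t₁ t₂ t₃ h₁ h₂ h₃
      convert (M j ⟨t₁, h₁⟩ ⟨t₂, h₂⟩ ⟨t₃, h₃⟩).2 using 1
      exact funext fun s => hQ j₀ j s₀ s _ _ _ _ _ _ rfl rfl rfl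
end

section
/- Let p be a prime and H = (H, (R j)_{j ∈ J}) a finite relational structure such that some R j₀ is the full unary relation on H (n j₀ = 1 and R j₀ consists of all unary tuples). Then H has a p-automorphism (an automorphism π with π ≠ id and π^p = id) if and only if there exists a family of bijections π j : R j → R j, one for each j ∈ J, not all equal to the identity, such that π j^p = id for every j, and for all j, j' ∈ J, all s ∈ Fin (n j), t ∈ Fin (n j'), and all a ∈ R j, b ∈ R j', one has a s = b t if and only if (π j a) s = (π j' b) t. In particular, H is p-rigid if and only if its binarization b(H) is p-rigid. -/
/-- A `p`-automorphism of the binarization `b(H)`: a family of bijections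
`Π j : R j ≃ R j`, not all the identity, each of order dividing `p`, that
preserves all coordinate-agreement relations (in both directions). -/
def IsBinPAut {J : Type} (n : J → ℕ) {H : Type}
    (R : ∀ j, Set (Fin (n j) → H)) (p : ℕ) (Pi : ∀ j, Equiv.Perm (R j)) : Prop :=
  (∃ j, Pi j ≠ 1) ∧ (∀ j, (Pi j) ^ p = 1) ∧
  ∀ j j' : J, ∀ s : Fin (n j), ∀ t : Fin (n j'), ∀ a : R j, ∀ b : R j',
    ((a : Fin (n j) → H) s = (b : Fin (n j') → H) t ↔
      ((Pi j) a : Fin (n j) → H) s = ((Pi j') b : Fin (n j') → H) t)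

/-- The permutation of a relation induced by an automorphism acting coordinatewise. -/
def inducedPerm {m : ℕ} {H : Type} (S : Set (Fin m → H)) (π : Equiv.Perm H)
    (h : ∀ t ∈ S, (fun s => π (t s)) ∈ S) (h' : ∀ t ∈ S, (fun s => π.symm (t s)) ∈ S) :
    Equiv.Perm S where
  toFun a := ⟨fun s => π (a.1 s), h a.1 a.2⟩
  invFun a := ⟨fun s => π.symm (a.1 s), h' a.1 a.2⟩
  left_inv a := by simp
  right_inv a := by simp

/-- If `σ` acts coordinatewise through `π`, then so do its powers. -/
theorem pow_apply_coord {m : ℕ} {H : Type} {S : Set (Fin m → H)} {σ : Equiv.Perm S}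
    {π : Equiv.Perm H} (h : ∀ a s, (σ a).1 s = π (a.1 s)) (k : ℕ) (a : S) (s : Fin m) :
    ((σ ^ k) a).1 s = (π ^ k) (a.1 s) := by
  induction k generalizing a with
  | zero => simp
  | succ k ih => rw [pow_succ, pow_succ, Equiv.Perm.mul_apply, Equiv.Perm.mul_apply, ih, h]

/-- The identification of a set with its full unary relation. -/
def equivFullUnary {m : ℕ} {H : Type} {S : Set (Fin m → H)} (hm : m = 1) (hS : S = Set.univ) :
    H ≃ S where
  toFun x := ⟨fun _ => x, hS ▸ Set.mem_univ _⟩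
  invFun a := a.1 ⟨0, by omega⟩
  left_inv _ := rfl
  right_inv a := by
    subst hm
    ext s
    exact congrArg a.1 (Subsingleton.elim _ _)

/-- A `p`-automorphism induces a `p`-automorphism of the binarization. -/
theorem IsPAut.exists_isBinPAut {J : Type} {n : J → ℕ} {H : Type}
    {R : ∀ j, Set (Fin (n j) → H)} {p : ℕ} {π : Equiv.Perm H} (hπ : IsPAut n R p π)
    {j₀ : J} (hj₀ : n j₀ = 1) (hfull : R j₀ = Set.univ) :
    ∃ Pi : ∀ j, Equiv.Perm (R j), IsBinPAut n R p Pi := by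
  obtain ⟨h, h', hne, hpow⟩ := hπ
  refine ⟨fun j => inducedPerm (R j) π (h j) (h' j), ⟨j₀, fun hid => hne ?_⟩, fun j => ?_, ?_⟩
  · ext x
    exact congrArg (equivFullUnary hj₀ hfull).symm
      (Equiv.congr_fun hid (equivFullUnary hj₀ hfull x))
  · ext a s
    rw [pow_apply_coord (π := π) (fun _ _ => rfl), hpow]
    rfl
  · intro j j' s t a b
    exact π.injective.eq_iff.symm

/-- A `p`-automorphism of the binarization of a structure with a full unary relation comes
from a `p`-automorphism of the structure. -/
theorem IsBinPAut.exists_isPAut {J : Type} {n : J → ℕ} {H : Type}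
    {R : ∀ j, Set (Fin (n j) → H)} {p : ℕ} {Pi : ∀ j, Equiv.Perm (R j)}
    (hPi : IsBinPAut n R p Pi) {j₀ : J} (hj₀ : n j₀ = 1) (hfull : R j₀ = Set.univ) :
    ∃ π : Equiv.Perm H, IsPAut n R p π := by
  obtain ⟨⟨j₁, hne⟩, hpow, hagree⟩ := hPi
  set e := equivFullUnary hj₀ hfull
  set π : Equiv.Perm H := e.symm.permCongrHom (Pi j₀) with hπ
  have key : ∀ j (a : R j) s, (Pi j a).1 s = π (a.1 s) := fun j a s =>
    (hagree j j₀ s ⟨0, by omega⟩ a (e (a.1 s))).1 rfl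
  refine ⟨π, fun j t ht => ?_, fun j t ht => ?_, fun hid => hne ?_, ?_⟩
  · have : (fun s => π (t s)) = (Pi j ⟨t, ht⟩).1 := funext fun s => (key j ⟨t, ht⟩ s).symm
    exact this ▸ (Pi j ⟨t, ht⟩).2
  · have : (fun s => π.symm (t s)) = ((Pi j).symm ⟨t, ht⟩).1 := funext fun s => by
      rw [Equiv.symm_apply_eq, ← key, Equiv.apply_symm_apply]
    exact this ▸ ((Pi j).symm ⟨t, ht⟩).2
  · ext a s
    rw [key, hid]
    rfl
  · rw [hπ, ← map_pow, hpow, map_one]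

theorem stmt14 {J : Type} [Fintype J] (n : J → ℕ) (hn : ∀ j, 1 ≤ n j)
    {H : Type} [Fintype H] [Nonempty H]
    (R : ∀ j, Set (Fin (n j) → H))
    (p : ℕ) (hp : p.Prime)
    (j₀ : J) (hj₀ : n j₀ = 1) (hfull : R j₀ = Set.univ) :
    ((∃ π : Equiv.Perm H, IsPAut n R p π) ↔ (∃ Pi : ∀ j, Equiv.Perm (R j), IsBinPAut n R p Pi)) ∧
    ((¬ ∃ π : Equiv.Perm H, IsPAut n R p π) ↔
      (¬ ∃ Pi : ∀ j, Equiv.Perm (R j), IsBinPAut n R p Pi)) := by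
  have h : (∃ π : Equiv.Perm H, IsPAut n R p π) ↔
      (∃ Pi : ∀ j, Equiv.Perm (R j), IsBinPAut n R p Pi) :=
    ⟨fun ⟨_, hπ⟩ => hπ.exists_isBinPAut hj₀ hfull, fun ⟨_, hPi⟩ => hPi.exists_isPAut hj₀ hfull⟩
  exact ⟨h, not_congr h⟩
end
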